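/- Let F be a field of characteristic zero. For k = 3 and k = 4, the maximal permanental ideal I_{k,k+1} of the generic k×(k+1) matrix has height k+1; i.e., Ideal.height I_{3,4} = 4 and Ideal.height I_{4,5} = 5. Equivalently, P_{3,4} and P_{4,5} are complete intersections of codimension 4 and 5 respectively. -/

import Mathlib

open MvPolynomial

noncomputable section

/-- The permanent of a square matrix. -/
def perm {R : Type*} [CommRing R] {m : ℕ} (A : Matrix (Fin m) (Fin m) R) : R :=
  ∑ σ : Equiv.Perm (Fin m), ∏ i, A i (σ i)

/-- The height of an ideal: the infimum of the heights (in the prime spectrum)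
of the primes containing it. -/
def idealHeight {R : Type*} [CommRing R] (I : Ideal R) : ℕ∞ :=
  ⨅ (p : PrimeSpectrum R) (_ : I ≤ p.asIdeal), Order.height p

/-- The maximal permanental ideal `I_{k,k+1}`: the ideal generated by the `k + 1`
permanents of the `k × k` submatrices of the generic `k × (k+1)` matrix obtained by
deleting one column. -/
def permanentalIdeal (F : Type*) [Field F] (k : ℕ) :
    Ideal (MvPolynomial (Fin k × Fin (k + 1)) F) :=
  Ideal.span (Set.range fun j : Fin (k + 1) =>
    perm (Matrix.of fun i i' : Fin k => X (i, j.succAbove i')))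

theorem height_comap_C_le {A : Type*} [CommRing A] (P : PrimeSpectrum (Polynomial A)) :
    Order.height (P.comap Polynomial.C) ≤
      Order.height (⟨(P.asIdeal.comap Polynomial.C).map Polynomial.C,
        Ideal.isPrime_map_C_of_isPrime⟩ : PrimeSpectrum (Polynomial A)) := by
  let φ : PrimeSpectrum A → PrimeSpectrum (Polynomial A) := fun q =>
    ⟨q.asIdeal.map Polynomial.C, Ideal.isPrime_map_C_of_isPrime⟩
  have hφ : StrictMono φ := by
    intro p q hpq
    refine lt_of_le_of_ne (Ideal.map_mono hpq.le) fun h => hpq.not_ge ?_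
    intro a ha
    have h1 : Polynomial.C a ∈ (φ p).asIdeal := h ▸ Ideal.mem_map_of_mem _ ha
    simpa using (Ideal.mem_map_C_iff.mp h1) 0
  exact Order.height_le_height_apply_of_strictMono φ hφ (P.comap Polynomial.C)

/-- A prime of `F[x₁, …, xₙ]` that is the kernel of evaluation at a point of a field `Ω` has height
at least `n` minus the transcendence degree generated by the coordinates. -/
theorem le_height_ker_aeval_add_eRk {F Ω : Type*} [Field F] [Field Ω] [Algebra F Ω] :
    ∀ (n : ℕ) (x : Fin n → Ω),
      (n : ℕ∞) ≤ Order.height ((⊥ : PrimeSpectrum Ω).comap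
        (aeval x : MvPolynomial (Fin n) F →ₐ[F] Ω).toRingHom) +
          (AlgebraicIndependent.matroid F Ω).eRk (Set.range x)
  | 0, x => by simp
  | n + 1, x => by
    have ih := le_height_ker_aeval_add_eRk n (Fin.tail x) (F := F)
    set p := (⊥ : PrimeSpectrum Ω).comap (aeval (Fin.tail x) : MvPolynomial (Fin n) F →ₐ[F] Ω).toRingHom
    let Ψ : Polynomial (MvPolynomial (Fin n) F) →+* Ω :=
      (aeval x : MvPolynomial (Fin (n + 1)) F →ₐ[F] Ω).toRingHom.comp
        (finSuccEquiv F n).symm.toRingEquiv.toRingHom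
    have hΨ : Ψ = Polynomial.eval₂RingHom
        (aeval (Fin.tail x) : MvPolynomial (Fin n) F →ₐ[F] Ω).toRingHom (x 0) := by
      have h0 : (finSuccEquiv F n).symm Polynomial.X = X 0 := by
        rw [AlgEquiv.symm_apply_eq, finSuccEquiv_X_zero]
      have h1 (j : Fin n) : (finSuccEquiv F n).symm (Polynomial.C (X j)) = X j.succ := by
        rw [AlgEquiv.symm_apply_eq, finSuccEquiv_X_succ]
      have h2 (a : F) : (finSuccEquiv F n).symm (Polynomial.C (C a)) = C a := by
        rw [AlgEquiv.symm_apply_eq, finSuccEquiv_apply]; simp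
      ext
      · simp [Ψ, h2]
      · simp [Ψ, h1, Fin.tail]
      · simp [Ψ, h0]
    set Q := (⊥ : PrimeSpectrum Ω).comap Ψ
    have hPQ : Order.height ((⊥ : PrimeSpectrum Ω).comap
        (aeval x : MvPolynomial (Fin (n + 1)) F →ₐ[F] Ω).toRingHom) = Order.height Q := by
      rw [← Order.height_orderIso (PrimeSpectrum.comapEquiv (finSuccEquiv F n).symm.toRingEquiv).symm]
      rfl
    have hQp : Q.comap Polynomial.C = p := by
      ext a
      simp [Q, p, hΨ]
    have hle := height_comap_C_le Q
    have hmem : ∀ f, f ∈ Q.asIdeal ↔ Ψ f = 0 := fun f => by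
      simp [Q]
    have hmap : (Q.asIdeal.comap Polynomial.C).map Polynomial.C ≤ Q.asIdeal := Ideal.map_comap_le
    rw [hQp] at hle
    rw [hPQ]
    have hrange : Set.range x = insert (x 0) (Set.range (Fin.tail x)) := by
      rw [← Fin.cons_self_tail x, Fin.range_cons]; simp
    rw [hrange]
    by_cases hx : x 0 ∈ (AlgebraicIndependent.matroid F Ω).closure (Set.range (Fin.tail x))
    · have halg := hx
      rw [AlgebraicIndependent.matroid_closure_eq, SetLike.mem_coe,
        Subalgebra.mem_algebraicClosure, Algebra.adjoin_range_eq_range_aeval] at halg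
      obtain ⟨g, hg0, hg⟩ := halg
      obtain ⟨G, rfl⟩ := Polynomial.map_surjective
        (aeval (Fin.tail x) : MvPolynomial (Fin n) F →ₐ[F] Ω).rangeRestrict.toRingHom
        (AlgHom.rangeRestrict_surjective _) g
      have hGQ : G ∈ Q.asIdeal := by
        rw [hmem, hΨ]
        rw [Polynomial.aeval_def, Polynomial.eval₂_map] at hg
        exact hg
      have hGn : G ∉ (Q.asIdeal.comap Polynomial.C).map Polynomial.C := by
        intro hG
        apply hg0
        ext i
        have h1 := Ideal.mem_map_C_iff.mp hG i
        rw [Ideal.mem_comap, hmem, hΨ] at h1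
        simpa using h1
      have hlt := Order.height_add_one_le (show (⟨(Q.asIdeal.comap Polynomial.C).map Polynomial.C,
        Ideal.isPrime_map_C_of_isPrime⟩ : PrimeSpectrum (Polynomial (MvPolynomial (Fin n) F))) < Q
          from lt_of_le_of_ne hmap fun h => hGn (by
            have := congrArg PrimeSpectrum.asIdeal h
            simp only at this
            rw [this]; exact hGQ))
      rw [← Matroid.eRk_closure_eq, Matroid.closure_insert_eq_of_mem_closure hx,
        Matroid.eRk_closure_eq]
      generalize (AlgebraicIndependent.matroid F Ω).eRk (Set.range (Fin.tail x)) = r at ih ⊢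
      calc ((n + 1 : ℕ) : ℕ∞) = n + 1 := by push_cast; rfl
        _ ≤ Order.height p + r + 1 := by gcongr
        _ = (Order.height p + 1) + r := by ring
        _ ≤ _ := by gcongr; exact le_trans (by gcongr) hlt
    · rw [Matroid.eRk_insert_eq_add_one ⟨by simp, hx⟩]
      generalize (AlgebraicIndependent.matroid F Ω).eRk (Set.range (Fin.tail x)) = r at ih ⊢
      calc ((n + 1 : ℕ) : ℕ∞) = n + 1 := by push_cast; rfl
        _ ≤ Order.height p + r + 1 := by gcongr
        _ = Order.height p + (r + 1) := by ring
        _ ≤ _ := by gcongr; exact hle.trans (Order.height_mono hmap)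

theorem card_le_height_ker_aeval_add {F Ω σ : Type*} [Field F] [Field Ω] [Algebra F Ω] [Fintype σ]
    (x : σ → Ω) (T : Set Ω)
    (hT : ∀ i, x i ∈ (AlgebraicIndependent.matroid F Ω).closure T) :
    (Fintype.card σ : ℕ∞) ≤ Order.height ((⊥ : PrimeSpectrum Ω).comap
        (aeval x : MvPolynomial σ F →ₐ[F] Ω).toRingHom) + T.encard := by
  let e := Fintype.equivFin σ
  refine (le_height_ker_aeval_add_eRk (F := F) _ (x ∘ e.symm)).trans (add_le_add (le_of_eq ?_) ?_)
  · rw [← Order.height_orderIso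
      (PrimeSpectrum.comapEquiv (renameEquiv F e).symm.toRingEquiv)]
    congr 1
    ext f
    obtain ⟨g, rfl⟩ := (renameEquiv F e).symm.surjective f
    simp [PrimeSpectrum.comapEquiv, aeval_rename]
  · calc _ ≤ (AlgebraicIndependent.matroid F Ω).eRk
          ((AlgebraicIndependent.matroid F Ω).closure T) := by
          apply Matroid.eRk_mono
          rintro _ ⟨i, rfl⟩
          exact hT _
      _ ≤ _ := by rw [Matroid.eRk_closure_eq]; exact Matroid.eRk_le_encard _ _

/-- If the coordinates of a point `x` are not all algebraic over `F(T)`, the point can be rescaled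
and specialized to a nonzero point over a field of characteristic zero, in such a way that the
rescaled elements of `T` specialize to zero. -/
theorem exists_specialization_of_notMem_closure {F ι Ω : Type*} [Field F] [CharZero F]
    [Field Ω] [Algebra F Ω] [Finite ι] (x : ι → Ω) (T : Set Ω)
    (hT : ∃ i, x i ∉ (AlgebraicIndependent.matroid F Ω).closure T) :
    ∃ (V : ValuationSubring Ω) (_ : CharZero (IsLocalRing.ResidueField V)) (a : Ω) (w : ι → V),
      a ≠ 0 ∧ (∀ i, x i = a * w i) ∧ (∃ i, IsLocalRing.residue V (w i) ≠ 0) ∧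
        ∀ t : V, a * t ∈ T → IsLocalRing.residue V t = 0 := by
  obtain ⟨i, hi⟩ := hT
  have hi' : x i ∉ (integralClosure (Subring.closure (Set.range (algebraMap F Ω) ∪ T)) Ω).toSubring := by
    refine fun h => hi ?_
    rw [AlgebraicIndependent.matroid_closure_eq, SetLike.mem_coe, Subalgebra.mem_algebraicClosure]
    have h1 : IsIntegral (Subring.closure (Set.range (algebraMap F Ω) ∪ T)) (x i) := h
    have hle : Subring.closure (Set.range (algebraMap F Ω) ∪ T) ≤
        (Algebra.adjoin F T).toSubring := by
      rw [Subring.closure_le, Set.union_subset_iff]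
      refine ⟨?_, fun t ht => Algebra.subset_adjoin ht⟩
      rintro _ ⟨r, rfl⟩
      exact Subalgebra.algebraMap_mem _ r
    obtain ⟨p, hp, hp0⟩ := h1
    refine IsIntegral.isAlgebraic ⟨p.map (Subring.inclusion hle), hp.map _, ?_⟩
    rw [Polynomial.eval₂_map]
    exact hp0
  rw [← iInf_valuationSubring_superset, Subring.mem_iInf] at hi'
  push Not at hi'
  obtain ⟨⟨V, hV⟩, hiV⟩ := hi'
  have hiV' : x i ∉ V := hiV
  have : Nonempty ι := ⟨i⟩
  obtain ⟨m, hm⟩ := Finite.exists_max (fun j => V.valuation (x j))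
  have hm1 : 1 < V.valuation (x m) := by
    refine lt_of_lt_of_le ?_ (hm i)
    by_contra h
    exact hiV' ((V.valuation_le_one_iff _).mp (not_lt.mp h))
  have ha : x m ≠ 0 := by
    intro h
    rw [h, map_zero] at hm1
    exact absurd hm1 (by simp)
  have hva : V.valuation (x m) ≠ 0 := by simpa using ha
  have hw : ∀ j, x j / x m ∈ V := fun j => by
    rw [← V.valuation_le_one_iff, map_div₀]
    exact div_le_one_of_le₀ (hm j) zero_le
  have hF : ∀ r : F, algebraMap F Ω r ∈ V := fun r => hV (Or.inl ⟨r, rfl⟩)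
  have hchar : CharZero (IsLocalRing.ResidueField V) := by
    let ψ : F →+* IsLocalRing.ResidueField V :=
      (IsLocalRing.residue V).comp ((algebraMap F Ω).codRestrict V.toSubring hF)
    exact charZero_of_injective_ringHom ψ.injective
  refine ⟨V, hchar, x m, fun j => ⟨x j / x m, hw j⟩, ha, fun j => ?_, ⟨m, ?_⟩, fun t ht => ?_⟩
  · rw [mul_div_cancel₀ _ ha]
  · have : (⟨x m / x m, hw m⟩ : V) = 1 := Subtype.ext (div_self ha)
    simp [this]
  · rw [IsLocalRing.residue_eq_zero_iff, V.valuation_lt_one_iff]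
    have htV : x m * t ∈ V := hV (Or.inr ht)
    have h2 := (V.valuation_le_one_iff _).mpr htV
    rw [map_mul] at h2
    by_contra h3
    exact absurd h2 (not_le.mpr (lt_of_lt_of_le hm1 (le_mul_of_one_le_right' (not_lt.mp h3))))

theorem perm_zero {R : Type*} [CommRing R] (A : Matrix (Fin 0) (Fin 0) R) : perm A = 1 := by
  simp [perm]

/-- Laplace expansion of the permanent along the first row. -/
theorem perm_succ {R : Type*} [CommRing R] {m : ℕ} (A : Matrix (Fin (m + 1)) (Fin (m + 1)) R) :
    perm A = ∑ j, A 0 j * perm (A.submatrix Fin.succ j.succAbove) := by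
  unfold perm
  rw [← Equiv.Perm.decomposeFin.symm.sum_comp, Fintype.sum_prod_type]
  refine Finset.sum_congr rfl fun p _ => ?_
  rw [Finset.mul_sum]
  induction p using Fin.cases with
  | zero =>
    refine Finset.sum_congr rfl fun e _ => ?_
    simp [Fin.prod_univ_succ]
  | succ p =>
    rw [← Equiv.sum_comp (Equiv.mulLeft p.cycleRange⁻¹)]
    refine Finset.sum_congr rfl fun e _ => ?_
    simp [Fin.prod_univ_succ, ← Fin.succAbove_cycleRange]

theorem map_perm {R S : Type*} [CommRing R] [CommRing S] (φ : R →+* S) {m : ℕ}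
    (A : Matrix (Fin m) (Fin m) R) : φ (perm A) = perm (A.map φ) := by
  simp [perm]

/-- For an `m × (m + 2)` matrix `A`, the matrix whose `(c, j)` entry is the coefficient of the
`j`-th variable of an extra first row in the maximal permanent avoiding column `c`. -/
def pairPerm {R : Type*} [CommRing R] {m : ℕ} (A : Matrix (Fin m) (Fin (m + 2)) R) :
    Matrix (Fin (m + 2)) (Fin (m + 2)) R :=
  Matrix.of fun c j => ∑ i, if c.succAbove i = j then
    perm (A.submatrix id (c.succAbove ∘ i.succAbove)) else 0

theorem perm_deleteColumn_eq_sum {R : Type*} [CommRing R] {m : ℕ}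
    (M : Matrix (Fin (m + 1)) (Fin (m + 2)) R) (c : Fin (m + 2)) :
    perm (M.submatrix id c.succAbove) =
      ∑ j, M 0 j * pairPerm (M.submatrix Fin.succ id) c j := by
  rw [perm_succ]
  simp only [pairPerm, Matrix.of_apply, Finset.mul_sum]
  rw [Finset.sum_comm]
  refine Finset.sum_congr rfl fun i _ => ?_
  simp [Matrix.submatrix_submatrix]

theorem pairPerm_map {R S : Type*} [CommRing R] [CommRing S] (φ : R →+* S) {m : ℕ}
    (A : Matrix (Fin m) (Fin (m + 2)) R) : pairPerm (A.map φ) = (pairPerm A).map φ := by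
  ext c j
  simp only [pairPerm, Matrix.of_apply, Matrix.map_apply, map_sum, apply_ite φ, map_zero, map_perm,
    Matrix.submatrix_map]

theorem perm_smul {R : Type*} [CommRing R] {m : ℕ} (a : R) (A : Matrix (Fin m) (Fin m) R) :
    perm (a • A) = a ^ m * perm A := by
  simp [perm, Finset.prod_mul_distrib, Finset.mul_sum]

theorem pairPerm_smul {R : Type*} [CommRing R] {m : ℕ} (a : R)
    (A : Matrix (Fin m) (Fin (m + 2)) R) : pairPerm (a • A) = a ^ m • pairPerm A := by
  ext c j
  simp [pairPerm, Matrix.submatrix_smul, perm_smul, Finset.mul_sum]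

/-- All minors of size `r` of `pairPerm A` vanish. -/
def MinorsVanish {R : Type*} [CommRing R] {m : ℕ} (r : ℕ) (A : Matrix (Fin m) (Fin (m + 2)) R) :
    Prop :=
  ∀ f g : Fin r → Fin (m + 2), ((pairPerm A).submatrix f g).det = 0

theorem MinorsVanish.succ {R : Type*} [CommRing R] {m r : ℕ} {A : Matrix (Fin m) (Fin (m + 2)) R}
    (h : MinorsVanish r A) : MinorsVanish (r + 1) A := by
  intro f g
  rw [Matrix.det_succ_row_zero]
  refine Finset.sum_eq_zero fun j _ => ?_
  rw [Matrix.submatrix_submatrix, h, mul_zero]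

theorem MinorsVanish.map {R S : Type*} [CommRing R] [CommRing S] (φ : R →+* S) {m r : ℕ}
    {A : Matrix (Fin m) (Fin (m + 2)) R} (h : MinorsVanish r A) : MinorsVanish r (A.map φ) := by
  intro f g
  have := congrArg φ (h f g)
  rw [map_zero, RingHom.map_det] at this
  rw [pairPerm_map]
  exact this

theorem MinorsVanish.of_map {R S : Type*} [CommRing R] [CommRing S] (φ : R →+* S)
    (hφ : Function.Injective φ) {m r : ℕ}
    {A : Matrix (Fin m) (Fin (m + 2)) R} (h : MinorsVanish r (A.map φ)) : MinorsVanish r A := by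
  intro f g
  have := h f g
  rw [pairPerm_map] at this
  apply hφ
  rw [map_zero, RingHom.map_det]
  exact this

theorem MinorsVanish.of_smul {R : Type*} [CommRing R] [IsDomain R] {a : R} (ha : a ≠ 0) {m r : ℕ}
    {A : Matrix (Fin m) (Fin (m + 2)) R} (h : MinorsVanish r (a • A)) : MinorsVanish r A := by
  intro f g
  have := h f g
  rw [pairPerm_smul, Matrix.submatrix_smul, Pi.smul_apply, Pi.smul_apply, Matrix.det_smul] at this
  exact (mul_eq_zero.mp this).resolve_left (pow_ne_zero _ (pow_ne_zero _ ha))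

/-- There is a section of the space of `m × (m + 2)` matrices, by the linear equations expressing
the entries in terms of `s` distinguished ones with integral coefficients `c`, that meets the locus
where the minors of size `r` of `pairPerm` vanish only in the origin. -/
def HasTrivialSection.{u} (m r s : ℕ) : Prop :=
  ∃ (ρ : Fin s → Fin m × Fin (m + 2)) (c : Fin s → Matrix (Fin m) (Fin (m + 2)) ℤ),
    Function.Injective ρ ∧ ∀ (K : Type u) [Field K] [CharZero K] (A : Matrix (Fin m) (Fin (m + 2)) K),
      MinorsVanish r A →
      (∀ i, i ∉ Set.range ρ → A i.1 i.2 = ∑ k, (c k i.1 i.2 : K) * A (ρ k).1 (ρ k).2) → A = 0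

theorem HasTrivialSection.of_succ.{u} {m r s : ℕ} (h : HasTrivialSection.{u} m (r + 1) s) :
    HasTrivialSection.{u} m r s := by
  obtain ⟨ρ, c, hρ, h⟩ := h
  exact ⟨ρ, c, hρ, fun K _ _ A hA => h K A hA.succ⟩

theorem HasTrivialSection.exists_closure.{u} {F : Type*} {Ω : Type u} [Field F] [CharZero F]
    [Field Ω] [Algebra F Ω] {m r s : ℕ} (h : HasTrivialSection.{u} m r s)
    (A : Matrix (Fin m) (Fin (m + 2)) Ω) (hA : MinorsVanish r A) :
    ∃ T : Finset Ω, T.card + s ≤ m * (m + 2) ∧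
      ∀ i j, A i j ∈ (AlgebraicIndependent.matroid F Ω).closure T := by
  classical
  obtain ⟨ρ, c, hρ, h⟩ := h
  let l : Fin m × Fin (m + 2) → Ω := fun i =>
    A i.1 i.2 - ∑ k, (c k i.1 i.2 : Ω) * A (ρ k).1 (ρ k).2
  let U := (Finset.univ.image ρ)ᶜ
  refine ⟨U.image l, ?_, ?_⟩
  · have h1 : (U.image l).card ≤ U.card := Finset.card_image_le
    have h2 : (Finset.univ.image ρ).card = s := by
      rw [Finset.card_image_of_injective _ hρ, Finset.card_univ, Fintype.card_fin]
    have h3 : U.card + (Finset.univ.image ρ).card = m * (m + 2) := by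
      rw [Finset.card_compl_add_card]; simp
    omega
  · by_contra! hcl
    obtain ⟨i, j, hij⟩ := hcl
    obtain ⟨V, _, a, w, ha, hw, ⟨i₀, hi₀⟩, ht⟩ := exists_specialization_of_notMem_closure (F := F)
      (fun i : Fin m × Fin (m + 2) => A i.1 i.2) _ ⟨(i, j), hij⟩
    let W : Matrix (Fin m) (Fin (m + 2)) V := Matrix.of fun i j => w (i, j)
    have hAW : A = a • W.map (algebraMap V Ω) := by
      ext i j
      exact hw (i, j)
    have hW : MinorsVanish r W := by
      rw [hAW] at hA
      exact (hA.of_smul ha).of_map _ (IsFractionRing.injective V Ω)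
    refine hi₀ (congrFun (congrFun (h _ _ (hW.map (IsLocalRing.residue V)) fun i hi => ?_) i₀.1) i₀.2)
    have := ht (w i - ∑ k, (c k i.1 i.2 : V) * w (ρ k)) (by
      simp only [Finset.coe_image, Set.mem_image]
      refine ⟨i, by simpa [U] using hi, ?_⟩
      simp only [l, hw]
      push_cast
      rw [mul_sub, Finset.mul_sum]
      congr 1
      refine Finset.sum_congr rfl fun k _ => ?_
      ring)
    rw [map_sub, sub_eq_zero] at this
    simpa [W] using this

theorem pairPerm_mem {K : Type*} [Field K] {m : ℕ} (L : Subfield K)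
    (A : Matrix (Fin m) (Fin (m + 2)) K) (hA : ∀ i j, A i j ∈ L) (c j : Fin (m + 2)) :
    pairPerm A c j ∈ L := by
  let A' : Matrix (Fin m) (Fin (m + 2)) L := Matrix.of fun i j => ⟨A i j, hA i j⟩
  have : A = A'.map L.subtype := rfl
  rw [this, pairPerm_map]
  exact (pairPerm A' c j).2

/-- Solving a linear system for the unknowns in the columns of a nonzero minor. -/
theorem mem_of_det_submatrix_ne_zero {K ι κ : Type*} [Field K] [Fintype κ] {r : ℕ}
    (L : Subfield K) (B : Matrix ι κ K) (hB : ∀ i j, B i j ∈ L) (v : κ → K)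
    (hv : ∀ i, ∑ j, v j * B i j = 0) (f : Fin r → ι) (g : Fin r → κ)
    (hfg : (B.submatrix f g).det ≠ 0) (hg : Function.Injective g)
    (hvL : ∀ j, j ∉ Set.range g → v j ∈ L) (j : κ) : v j ∈ L := by
  classical
  by_cases hj : j ∈ Set.range g
  swap
  · exact hvL j hj
  obtain ⟨b, rfl⟩ := hj
  let B' : Matrix (Fin r) (Fin r) L := Matrix.of fun i j => ⟨B (f i) (g j), hB _ _⟩
  have hBB' : B.submatrix f g = B'.map L.subtype := rfl
  have hw : ∀ a, (B.submatrix f g).mulVec (v ∘ g) a ∈ L := by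
    intro a
    have h1 := hv (f a)
    rw [← Finset.sum_add_sum_compl (Finset.univ.image g),
      Finset.sum_image fun x _ y _ h => hg h] at h1
    have h2 : (B.submatrix f g).mulVec (v ∘ g) a = ∑ x, v (g x) * B (f a) (g x) := by
      simp [Matrix.mulVec, dotProduct, mul_comm]
    rw [h2, eq_neg_of_add_eq_zero_left h1]
    refine neg_mem (sum_mem fun j hj => mul_mem (hvL j ?_) (hB _ _))
    simpa using hj
  have hadj : (B.submatrix f g).det * v (g b) =
      ∑ a, (B.submatrix f g).adjugate b a * (B.submatrix f g).mulVec (v ∘ g) a := by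
    change _ = (B.submatrix f g).adjugate.mulVec ((B.submatrix f g).mulVec (v ∘ g)) b
    rw [Matrix.mulVec_mulVec, Matrix.adjugate_mul]
    simp [Matrix.smul_mulVec]
  have hdet : (B.submatrix f g).det ∈ L := by
    rw [hBB', ← RingHom.mapMatrix_apply, ← RingHom.map_det]
    exact B'.det.2
  have hsum : (B.submatrix f g).det * v (g b) ∈ L := by
    rw [hadj]
    refine sum_mem fun a _ => mul_mem ?_ (hw a)
    rw [hBB', ← RingHom.mapMatrix_apply, ← RingHom.map_adjugate]
    exact (B'.adjugate b a).2
  have := mul_mem (inv_mem hdet) hsum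
  rwa [inv_mul_cancel_left₀ hfg] at this

/-- The elements algebraic over the field generated by a set, as a subfield. -/
def closureSubfield (F : Type*) {Ω : Type*} [Field F] [Field Ω] [Algebra F Ω] (T : Set Ω) :
    Subfield Ω where
  toSubring := (Subalgebra.algebraicClosure (Algebra.adjoin F T) Ω).toSubring
  inv_mem' := fun x (hx : IsAlgebraic _ x) => (hx.inv : IsAlgebraic _ x⁻¹)

theorem mem_closureSubfield {F Ω : Type*} [Field F] [Field Ω] [Algebra F Ω] {T : Set Ω} {x : Ω} :
    x ∈ closureSubfield F T ↔ x ∈ (AlgebraicIndependent.matroid F Ω).closure T := by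
  rw [AlgebraicIndependent.matroid_closure_eq]
  rfl

theorem exists_closure_of_perm_eq_zero.{u} {F : Type*} {Ω : Type u} [Field F] [CharZero F]
    [Field Ω] [Algebra F Ω] {m : ℕ}
    (hsec : ∀ r < m + 2, ∃ s, m + 2 ≤ s + r ∧ HasTrivialSection.{u} m (r + 1) s)
    (M : Matrix (Fin (m + 1)) (Fin (m + 2)) Ω)
    (hM : ∀ c : Fin (m + 2), perm (M.submatrix id c.succAbove) = 0) :
    ∃ T : Finset Ω, T.card ≤ m * (m + 2) ∧
      ∀ i j, M i j ∈ (AlgebraicIndependent.matroid F Ω).closure T := by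
  classical
  set A := M.submatrix Fin.succ id with hA
  obtain ⟨r, hr, ⟨f, g, hfg⟩, T, hTc, hT⟩ : ∃ r ≤ m + 2, (∃ f g : Fin r → Fin (m + 2),
      ((pairPerm A).submatrix f g).det ≠ 0) ∧ ∃ T : Finset Ω, T.card + (m + 2) ≤ m * (m + 2) + r ∧
      ∀ i j, A i j ∈ (AlgebraicIndependent.matroid F Ω).closure T := by
    have h0 : ¬ MinorsVanish 0 A := fun h => by simpa using h Fin.elim0 Fin.elim0
    let r := Nat.findGreatest (fun r => ¬ MinorsVanish r A) (m + 2)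
    have hr : ¬ MinorsVanish r A := Nat.findGreatest_spec (P := fun r => ¬ MinorsVanish r A)
      (Nat.zero_le (m + 2)) h0
    have hrle : r ≤ m + 2 := Nat.findGreatest_le _
    refine ⟨r, hrle, by simpa [MinorsVanish] using hr, ?_⟩
    rcases hrle.eq_or_lt with hreq | hrlt
    · refine ⟨Finset.univ.image fun i : Fin m × Fin (m + 2) => A i.1 i.2, ?_, fun i j => ?_⟩
      · have : (Finset.univ.image fun i : Fin m × Fin (m + 2) => A i.1 i.2).card ≤ m * (m + 2) :=
          Finset.card_image_le.trans (by simp)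
        omega
      · exact Matroid.mem_closure_of_mem' _
          (by rw [Finset.coe_image]; exact ⟨(i, j), by simp, rfl⟩)
    · obtain ⟨s, hs, hsec⟩ := hsec r hrlt
      have hvan : MinorsVanish (r + 1) A := by
        by_contra h
        exact Nat.findGreatest_is_greatest (P := fun r => ¬ MinorsVanish r A) (Nat.lt_succ_self r)
          (by omega) h
      obtain ⟨T, hT, hAT⟩ := hsec.exists_closure (F := F) A hvan
      exact ⟨T, by omega, hAT⟩
  have hg : Function.Injective g := by
    intro a b hab
    by_contra hne
    exact hfg (Matrix.det_zero_of_column_eq hne fun i => by simp [hab])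
  let U := (Finset.univ.image g)ᶜ
  have hU : U.card + r = m + 2 := by
    have := Finset.card_compl_add_card (Finset.univ.image g)
    rwa [Finset.card_image_of_injective _ hg, Finset.card_univ, Fintype.card_fin,
      Fintype.card_fin] at this
  let T' : Finset Ω := T ∪ U.image (M 0)
  have hT'1 : (T : Set Ω) ⊆ T' := by simp [T']
  have hT'2 : ∀ j ∈ U, M 0 j ∈ (T' : Set Ω) := fun j hj => by
    simp only [T', Finset.coe_union, Finset.coe_image]
    exact Or.inr ⟨j, hj, rfl⟩
  have hAmem : ∀ i j, A i j ∈ closureSubfield F (T' : Set Ω) := fun i j =>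
    mem_closureSubfield.mpr (Matroid.closure_subset_closure _ hT'1 (hT i j))
  refine ⟨T', ?_, fun i j => ?_⟩
  · have h1 : T'.card ≤ T.card + (U.image (M 0)).card := Finset.card_union_le _ _
    have h2 : (U.image (M 0)).card ≤ U.card := Finset.card_image_le
    omega
  · induction i using Fin.cases with
    | succ i => exact mem_closureSubfield.mp (hAmem i j)
    | zero =>
      refine mem_closureSubfield.mp (mem_of_det_submatrix_ne_zero _ (pairPerm A)
        (pairPerm_mem _ A hAmem) (M 0) (fun c => ?_) f g hfg hg (fun j hj => ?_) j)
      · rw [← perm_deleteColumn_eq_sum, hM]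
      · exact mem_closureSubfield.mpr (Matroid.mem_closure_of_mem' _ (hT'2 j (by simpa [U] using hj)))

theorem le_idealHeight_permanentalIdeal.{u} (F : Type u) [Field F] [CharZero F] {m : ℕ}
    (hsec : ∀ r < m + 2, ∃ s, m + 2 ≤ s + r ∧ HasTrivialSection.{u} m (r + 1) s) :
    ((m + 2 : ℕ) : ℕ∞) ≤ idealHeight (permanentalIdeal F (m + 1)) := by
  refine le_iInf₂ fun p hp => ?_
  let Ω := FractionRing (MvPolynomial (Fin (m + 1) × Fin (m + 1 + 1)) F ⧸ p.asIdeal)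
  let M : Matrix (Fin (m + 1)) (Fin (m + 2)) Ω := Matrix.of fun i j =>
    algebraMap (MvPolynomial (Fin (m + 1) × Fin (m + 1 + 1)) F ⧸ p.asIdeal) Ω
      (Ideal.Quotient.mk p.asIdeal (X (i, j)))
  let ψ : MvPolynomial (Fin (m + 1) × Fin (m + 1 + 1)) F →ₐ[F] Ω :=
    (IsScalarTower.toAlgHom F _ Ω).comp (Ideal.Quotient.mkₐ F p.asIdeal)
  have hψ : ψ = aeval fun i : Fin (m + 1) × Fin (m + 1 + 1) => M i.1 i.2 := by
    ext i
    simp [ψ, M]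
  have hker : (⊥ : PrimeSpectrum Ω).comap ψ.toRingHom = p := by
    ext f
    have : ψ f = algebraMap _ Ω (Ideal.Quotient.mk p.asIdeal f) := rfl
    simp [this, Ideal.Quotient.eq_zero_iff_mem]
  have hM : ∀ c : Fin (m + 2), perm (M.submatrix id c.succAbove) = 0 := by
    intro c
    have h1 : perm (Matrix.of fun i i' : Fin (m + 1) =>
        (X (i, c.succAbove i') : MvPolynomial (Fin (m + 1) × Fin (m + 1 + 1)) F)) ∈ p.asIdeal :=
      hp (Ideal.subset_span ⟨c, rfl⟩)
    rw [← hker] at h1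
    have h2 : ψ.toRingHom _ = 0 := h1
    rwa [map_perm] at h2
  obtain ⟨T, hT, hMT⟩ := exists_closure_of_perm_eq_zero (F := F) hsec M hM
  have h := card_le_height_ker_aeval_add (F := F)
    (fun i : Fin (m + 1) × Fin (m + 1 + 1) => M i.1 i.2) T fun i => hMT _ _
  rw [← hψ, hker, Set.encard_coe_eq_coe_finsetCard] at h
  have h3 : ((m + 2 : ℕ) : ℕ∞) + (m * (m + 2) : ℕ) ≤ Order.height p + (m * (m + 2) : ℕ) := by
    refine le_trans (le_of_eq ?_) (h.trans (by gcongr))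
    rw [← Nat.cast_add]
    congr 1
    simp
    ring
  exact (ENat.add_le_add_iff_right (ENat.natCast_ne_top _)).mp h3

theorem idealHeight_permanentalIdeal_le (F : Type*) [Field F] (k : ℕ) :
    idealHeight (permanentalIdeal F (k + 1)) ≤ ((k + 2 : ℕ) : ℕ∞) := by
  classical
  have hne : permanentalIdeal F (k + 1) ≠ ⊤ := by
    refine ne_top_of_le_ne_top (RingHom.ker_ne_top (eval (0 : Fin (k + 1) × Fin (k + 1 + 1) → F))) ?_
    rw [permanentalIdeal, Ideal.span_le]
    rintro _ ⟨c, rfl⟩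
    rw [SetLike.mem_coe, RingHom.mem_ker, map_perm, perm_succ]
    simp
  obtain ⟨p, hp⟩ := Ideal.nonempty_minimalPrimes hne
  have := hp.1.1
  refine (iInf₂_le (⟨p, hp.1.1⟩ : PrimeSpectrum _) hp.1.2).trans ?_
  rw [permanentalIdeal, ← Set.image_univ, ← Finset.coe_univ, ← Finset.coe_image] at hp
  refine (PrimeSpectrum.height_eq_orderHeight ⟨p, hp.1.1⟩).symm.trans_le
    ((Ideal.height_le_card_of_mem_minimalPrimes_span_finset hp).trans ?_)
  exact_mod_cast Finset.card_image_le.trans (by simp)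

theorem HasTrivialSection.intro.{u} {m r s : ℕ} (ρ : Fin s → Fin m × Fin (m + 2))
    (c : Fin s → Matrix (Fin m) (Fin (m + 2)) ℤ)
    (hc : ∀ k k', c k (ρ k').1 (ρ k').2 = if k = k' then 1 else 0)
    (h : ∀ (K : Type u) [Field K] [CharZero K] (y : Fin s → K),
      MinorsVanish r (Matrix.of fun i j => ∑ k, (c k i j : K) * y k) → y = 0) :
    HasTrivialSection.{u} m r s := by
  refine ⟨ρ, c, fun k k' hk => ?_, fun K _ _ A hA hlin => ?_⟩
  · by_contra hne
    have h1 := hc k k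
    have h2 := hc k k'
    rw [hk] at h1
    simp [h1, hne] at h2
  · have hAc : A = Matrix.of fun i j => ∑ k, (c k i j : K) * A (ρ k).1 (ρ k).2 := by
      ext i j
      by_cases hi : (i, j) ∈ Set.range ρ
      · obtain ⟨k', hk'⟩ := hi
        have h1 : i = (ρ k').1 := by rw [hk']
        have h2 : j = (ρ k').2 := by rw [hk']
        subst h1 h2
        simp [hc]
      · exact hlin _ hi
    rw [hAc] at hA
    have h0 := h K (fun k => A (ρ k).1 (ρ k).2) hA
    rw [hAc]
    ext i j
    simp only [Matrix.of_apply, Matrix.zero_apply]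
    exact Finset.sum_eq_zero fun k _ => by rw [show A (ρ k).1 (ρ k).2 = 0 from congrFun h0 k, mul_zero]

/-- The permanent of the `2 × 2` submatrix on columns `a`, `b`. -/
def perm₂ {R : Type*} [CommRing R] {n : ℕ} (A : Matrix (Fin 2) (Fin n) R) (a b : Fin n) : R :=
  A 0 a * A 1 b + A 0 b * A 1 a

/-- The permanent of the `3 × 3` submatrix on columns `a`, `b`, `c`. -/
def perm₃ {R : Type*} [CommRing R] {n : ℕ} (A : Matrix (Fin 3) (Fin n) R) (a b c : Fin n) : R :=
  A 0 a * (A 1 b * A 2 c + A 1 c * A 2 b) + A 0 b * (A 1 a * A 2 c + A 1 c * A 2 a) +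
    A 0 c * (A 1 a * A 2 b + A 1 b * A 2 a)

theorem perm_submatrix_two {R : Type*} [CommRing R] {n : ℕ} (A : Matrix (Fin 2) (Fin n) R)
    (f : Fin 2 → Fin n) : perm (A.submatrix id f) = perm₂ A (f 0) (f 1) := by
  simp [perm_succ, perm_zero, Fin.sum_univ_succ, perm₂, Fin.succAbove]

theorem perm_submatrix_three {R : Type*} [CommRing R] {n : ℕ} (A : Matrix (Fin 3) (Fin n) R)
    (f : Fin 3 → Fin n) : perm (A.submatrix id f) = perm₃ A (f 0) (f 1) (f 2) := by
  simp [perm_succ, perm_zero, Fin.sum_univ_succ, perm₃, Fin.succAbove]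
  ring

theorem pairPerm_self {R : Type*} [CommRing R] {m : ℕ} (A : Matrix (Fin m) (Fin (m + 2)) R)
    (c : Fin (m + 2)) : pairPerm A c c = 0 := by
  simp [pairPerm, Fin.succAbove_ne]

theorem pairPerm_succAbove {R : Type*} [CommRing R] {m : ℕ} (A : Matrix (Fin m) (Fin (m + 2)) R)
    (c : Fin (m + 2)) (i : Fin (m + 1)) :
    pairPerm A c (c.succAbove i) = perm (A.submatrix id (c.succAbove ∘ i.succAbove)) := by
  simp [pairPerm]

theorem pairPerm_two {R : Type*} [CommRing R] (A : Matrix (Fin 2) (Fin 4) R) :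
    pairPerm A = !![0, perm₂ A 2 3, perm₂ A 1 3, perm₂ A 1 2;
      perm₂ A 2 3, 0, perm₂ A 0 3, perm₂ A 0 2;
      perm₂ A 1 3, perm₂ A 0 3, 0, perm₂ A 0 1;
      perm₂ A 1 2, perm₂ A 0 2, perm₂ A 0 1, 0] := by
  ext c j
  induction j using c.succAboveCases with
  | x => rw [pairPerm_self]; fin_cases c <;> rfl
  | p i => rw [pairPerm_succAbove, perm_submatrix_two]; fin_cases c <;> fin_cases i <;> rfl

theorem pairPerm_three {R : Type*} [CommRing R] (A : Matrix (Fin 3) (Fin 5) R) :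
    pairPerm A = !![0, perm₃ A 2 3 4, perm₃ A 1 3 4, perm₃ A 1 2 4, perm₃ A 1 2 3;
      perm₃ A 2 3 4, 0, perm₃ A 0 3 4, perm₃ A 0 2 4, perm₃ A 0 2 3;
      perm₃ A 1 3 4, perm₃ A 0 3 4, 0, perm₃ A 0 1 4, perm₃ A 0 1 3;
      perm₃ A 1 2 4, perm₃ A 0 2 4, perm₃ A 0 1 4, 0, perm₃ A 0 1 2;
      perm₃ A 1 2 3, perm₃ A 0 2 3, perm₃ A 0 1 3, perm₃ A 0 1 2, 0] := by
  ext c j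
  induction j using c.succAboveCases with
  | x => rw [pairPerm_self]; fin_cases c <;> rfl
  | p i => rw [pairPerm_succAbove, perm_submatrix_three]; fin_cases c <;> fin_cases i <;> rfl

theorem hasTrivialSection_two_four_one : HasTrivialSection 2 4 1 := by
  refine HasTrivialSection.intro (fun _ => (0, 0)) (fun _ => Matrix.of fun _ _ => 1) ?_ ?_
  · intro k k'
    simp [Subsingleton.elim k k']
  · intro K _ _ y h
    have h1 : -48 * y 0 ^ 8 = 0 := by
      refine Eq.trans ?_ (h id id)
      rw [pairPerm_two]
      simp [perm₂, Matrix.det_succ_row_zero, Fin.sum_univ_succ, Fin.succAbove]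
      ring
    funext k
    rw [Subsingleton.elim k 0]
    simpa using h1

theorem hasTrivialSection_three_five_one : HasTrivialSection 3 5 1 := by
  refine HasTrivialSection.intro (fun _ => (0, 0)) (fun _ => Matrix.of fun _ _ => 1) ?_ ?_
  · intro k k'
    simp [Subsingleton.elim k k']
  · intro K _ _ y h
    have h1 : 31104 * y 0 ^ 15 = 0 := by
      refine Eq.trans ?_ (h id id)
      rw [pairPerm_three]
      simp [perm₃, Matrix.det_succ_row_zero, Fin.sum_univ_succ, Fin.succAbove]
      ring
    funext k
    rw [Subsingleton.elim k 0]
    simpa using h1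

theorem hasTrivialSection_two_three_two : HasTrivialSection 2 3 2 := by
  refine HasTrivialSection.intro ![(0, 0), (0, 1)]
    ![!![1, 0, 0, 0; 0, 1, -1, 2], !![0, 1, 1, 1; 1, 0, 0, 0]] ?_ ?_
  · decide
  · intro K _ _ y h
    obtain ⟨a, ha⟩ : ∃ a, y 0 = a := ⟨_, rfl⟩
    obtain ⟨b, hb⟩ : ∃ b, y 1 = b := ⟨_, rfl⟩
    have hA : (Matrix.of fun i j => ∑ k, ((![!![1, 0, 0, 0; 0, 1, -1, 2],
        !![0, 1, 1, 1; 1, 0, 0, 0]] k i j : ℤ) : K) * y k) = !![a, b, b, b; b, a, -a, 2 * a] := by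
      ext i j; fin_cases i <;> fin_cases j <;> simp [ha, hb]
    rw [hA, MinorsVanish, pairPerm_two] at h
    have h1 : 12 * a ^ 4 * b ^ 2 + 6 * a ^ 2 * b ^ 4 = 0 := by
      refine Eq.trans ?_ (h ![0, 1, 2] ![0, 1, 2])
      rw [Matrix.det_fin_three]
      simp [perm₂]
      ring
    have h2 : -4 * a ^ 4 * b ^ 2 + 2 * a ^ 2 * b ^ 4 = 0 := by
      refine Eq.trans ?_ (h ![0, 1, 2] ![0, 1, 3])
      rw [Matrix.det_fin_three]
      simp [perm₂]
      ring
    have h3 := h ![1, 2, 3] ![1, 2, 3]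
    rw [Matrix.det_fin_three] at h3
    simp [perm₂] at h3
    have hab : a = 0 ∨ b = 0 := by
      have : a ^ 4 * b ^ 2 = 0 := by linear_combination (h1 - 3 * h2) / 24
      simpa using this
    have : a = 0 ∧ b = 0 := by
      rcases hab with rfl | rfl
      · exact ⟨rfl, by ring_nf at h3; simpa using h3⟩
      · exact ⟨by ring_nf at h3; simpa using h3, rfl⟩
    funext k
    fin_cases k <;> simp [ha, hb, this]

theorem hasTrivialSection_two_two_four : HasTrivialSection 2 2 4 := by
  refine HasTrivialSection.intro (fun k => (0, k))
    ![!![1, 0, 0, 0; 0, 0, 0, 1], !![0, 1, 0, 0; 1, 0, 0, 0],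
      !![0, 0, 1, 0; 0, 1, 0, 0], !![0, 0, 0, 1; 0, 0, 1, 0]] ?_ ?_
  · decide
  · intro K _ _ y h
    have hA : (Matrix.of fun i j => ∑ k, ((![!![1, 0, 0, 0; 0, 0, 0, 1],
        !![0, 1, 0, 0; 1, 0, 0, 0], !![0, 0, 1, 0; 0, 1, 0, 0],
        !![0, 0, 0, 1; 0, 0, 1, 0]] k i j : ℤ) : K) * y k) =
        !![y 0, y 1, y 2, y 3; y 1, y 2, y 3, y 0] := by
      ext i j; fin_cases i <;> fin_cases j <;> simp [Fin.sum_univ_succ]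
    rw [hA] at h
    have hB (i j : Fin 4) : pairPerm !![y 0, y 1, y 2, y 3; y 1, y 2, y 3, y 0] i j *
        pairPerm !![y 0, y 1, y 2, y 3; y 1, y 2, y 3, y 0] j i = 0 := by
      have := h ![i, j] ![j, i]
      rw [Matrix.det_fin_two] at this
      simpa [pairPerm_self] using this
    rw [pairPerm_two] at hB
    have h01 := hB 0 1
    have h02 := hB 0 2
    have h03 := hB 0 3
    have h12 := hB 1 2
    have h13 := hB 1 3
    have h23 := hB 2 3
    simp [perm₂] at h01 h02 h03 h12 h13 h23
    have h0 : y 0 = 0 := by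
      have : y 0 ^ 3 = 0 := by
        linear_combination y 0 * h12 - (y 1 * h13 + y 0 * h03 - y 2 * h23) / 2
      simpa using this
    simp [h0] at h01 h23
    simp [h01, h23] at h03
    funext k
    fin_cases k <;> simp [*]

/-- The matrix whose `i`-th row is `y`, cyclically shifted by `i`. -/
def cyclicMatrix {R : Type*} {n m : ℕ} (y : Fin (m + n) → R) : Matrix (Fin m) (Fin (m + n)) R :=
  Matrix.of fun i j => y (j + i.castAdd n)

theorem cyclicMatrix_three_apply_zero {K : Type*} [Field K] [CharZero K] (y : Fin (3 + 2) → K)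
    (h : ∀ i j k : Fin (3 + 2), i ≠ j → i ≠ k → j ≠ k → perm₃ (cyclicMatrix y) i j k = 0) :
    y 0 = 0 := by
  have h012 := h 0 1 2 (by decide) (by decide) (by decide)
  have h013 := h 0 1 3 (by decide) (by decide) (by decide)
  have h014 := h 0 1 4 (by decide) (by decide) (by decide)
  have h023 := h 0 2 3 (by decide) (by decide) (by decide)
  have h024 := h 0 2 4 (by decide) (by decide) (by decide)
  have h034 := h 0 3 4 (by decide) (by decide) (by decide)
  have h123 := h 1 2 3 (by decide) (by decide) (by decide)
  have h124 := h 1 2 4 (by decide) (by decide) (by decide)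
  have h134 := h 1 3 4 (by decide) (by decide) (by decide)
  have h234 := h 2 3 4 (by decide) (by decide) (by decide)
  have hm : cyclicMatrix y = !![y 0, y 1, y 2, y 3, y 4; y 1, y 2, y 3, y 4, y 0;
      y 2, y 3, y 4, y 0, y 1] := by
    ext i j; fin_cases i <;> fin_cases j <;> rfl
  rw [hm] at h012 h013 h014 h023 h024 h034 h123 h124 h134 h234
  simp [perm₃] at h012 h013 h014 h023 h024 h034 h123 h124 h134 h234
  refine pow_eq_zero_iff (n := 5) (by norm_num) |>.mp ?_
  linear_combination (7 * y 0 * y 4) / 24 * h012 +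
    (15 * y 4^2 + 7 * y 0 * y 3) / 24 * h013 +
    (19 * y 3 * y 4) / 24 * h014 +
    (7 * y 0 * y 2 + 15 * y 1^2) / 24 * h023 +
    ((-15) * y 0 * y 1 - 17 * y 2 * y 4 + 3 * y 3^2) / 24 * h024 +
    ((-17) * y 2 * y 3 + 24 * y 0^2 + 3 * y 1 * y 4) / 24 * h034 +
    (7 * y 0 * y 1) / 24 * h123 +
    ((-21) * y 0^2 - 20 * y 1 * y 4 - 3 * y 2 * y 3) / 24 * h124 +
    ((-17) * y 1 * y 3 - 15 * y 0 * y 4 + 3 * y 2^2) / 24 * h134 +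
    (19 * y 1 * y 2) / 24 * h234

theorem cyclicMatrix_rotate {K : Type*} (y : Fin (3 + 2) → K) (t j : Fin (3 + 2)) (i : Fin 3) :
    cyclicMatrix (fun j => y (j + t)) i j = cyclicMatrix y i (j + t) := by
  simp [cyclicMatrix, add_right_comm]

theorem cyclicMatrix_three_eq_zero {K : Type*} [Field K] [CharZero K] (y : Fin (3 + 2) → K)
    (h : ∀ i j k : Fin (3 + 2), i ≠ j → i ≠ k → j ≠ k → perm₃ (cyclicMatrix y) i j k = 0) :
    y = 0 := by
  funext t
  have := cyclicMatrix_three_apply_zero (fun j => y (j + t)) fun i j k hij hik hjk => by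
    simpa only [perm₃, cyclicMatrix_rotate] using h (i + t) (j + t) (k + t)
      (by simpa using hij) (by simpa using hik) (by simpa using hjk)
  simpa using this

theorem hasTrivialSection_three_two_five : HasTrivialSection 3 2 5 := by
  refine HasTrivialSection.intro (fun k => (0, k))
    (fun k => cyclicMatrix (n := 2) fun j => if j = k then 1 else 0) ?_ ?_
  · intro k k'
    simp [cyclicMatrix, eq_comm]
  · intro K _ _ y h
    have hA : (Matrix.of fun i j => ∑ k : Fin 5,
        ((cyclicMatrix (n := 2) (fun j => if j = k then (1 : ℤ) else 0) i j : ℤ) : K) * y k) =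
        cyclicMatrix (n := 2) y := by
      ext i j
      simp [cyclicMatrix]
    rw [hA] at h
    refine cyclicMatrix_three_eq_zero y fun i j k hij hik hjk => ?_
    have hB (a b : Fin 5) : pairPerm (cyclicMatrix (n := 2) y) a b *
        pairPerm (cyclicMatrix (n := 2) y) b a = 0 := by
      have := h ![a, b] ![b, a]
      rw [Matrix.det_fin_two] at this
      simpa [pairPerm_self] using this
    rw [pairPerm_three] at hB
    have hlt (i j k : Fin 5) (hij : i < j) (hjk : j < k) :
        perm₃ (cyclicMatrix (n := 2) y) i j k = 0 := by
      have h01 := hB 0 1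
      have h02 := hB 0 2
      have h03 := hB 0 3
      have h04 := hB 0 4
      have h12 := hB 1 2
      have h13 := hB 1 3
      have h14 := hB 1 4
      have h23 := hB 2 3
      have h24 := hB 2 4
      have h34 := hB 3 4
      simp at h01 h02 h03 h04 h12 h13 h14 h23 h24 h34
      fin_cases i <;> fin_cases j <;> fin_cases k <;>
        first | (exfalso; revert hij hjk; decide) | assumption
    rcases lt_or_gt_of_ne hij with hij | hij <;> rcases lt_or_gt_of_ne hjk with hjk | hjk <;>
      rcases lt_or_gt_of_ne hik with hik | hik
    · exact hlt i j k hij hjk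
    · exact absurd (hij.trans hjk) hik.asymm
    · rw [← hlt i k j hik hjk]; unfold perm₃; ring
    · rw [← hlt k i j hik hij]; unfold perm₃; ring
    · rw [← hlt j i k hij hik]; unfold perm₃; ring
    · rw [← hlt j k i hjk hik]; unfold perm₃; ring
    · exact absurd (hjk.trans hij) hik.asymm
    · rw [← hlt k j i hjk hij]; unfold perm₃; ring

theorem det_fin_four {R : Type*} [CommRing R] (A : Matrix (Fin 4) (Fin 4) R) :
    A.det =
      A 0 0 * (A 1 1 * (A 2 2 * A 3 3 - A 2 3 * A 3 2) - A 1 2 * (A 2 1 * A 3 3 - A 2 3 * A 3 1) +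
        A 1 3 * (A 2 1 * A 3 2 - A 2 2 * A 3 1)) -
      A 0 1 * (A 1 0 * (A 2 2 * A 3 3 - A 2 3 * A 3 2) - A 1 2 * (A 2 0 * A 3 3 - A 2 3 * A 3 0) +
        A 1 3 * (A 2 0 * A 3 2 - A 2 2 * A 3 0)) +
      A 0 2 * (A 1 0 * (A 2 1 * A 3 3 - A 2 3 * A 3 1) - A 1 1 * (A 2 0 * A 3 3 - A 2 3 * A 3 0) +
        A 1 3 * (A 2 0 * A 3 1 - A 2 1 * A 3 0)) -
      A 0 3 * (A 1 0 * (A 2 1 * A 3 2 - A 2 2 * A 3 1) - A 1 1 * (A 2 0 * A 3 2 - A 2 2 * A 3 0) +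
        A 1 2 * (A 2 0 * A 3 1 - A 2 1 * A 3 0)) := by
  rw [Matrix.det_succ_row_zero]
  simp [Fin.sum_univ_succ, Matrix.det_fin_three, Fin.succAbove]
  ring

theorem hasTrivialSection_three_four_two : HasTrivialSection 3 4 2 := by
  refine HasTrivialSection.intro ![(2, 0), (2, 4)]
    ![!![0, 0, 0, 1, 1; 0, 1, 1, 0, 1; 1, 0, 1, 1, 0],
      !![-1, 1, 0, -1, 0; -1, 0, 1, -1, 0; 0, 0, 0, 0, 1]] ?_ ?_
  · decide
  · intro K _ _ y h
    obtain ⟨a, ha⟩ : ∃ a, y 0 = a := ⟨_, rfl⟩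
    obtain ⟨b, hb⟩ : ∃ b, y 1 = b := ⟨_, rfl⟩
    have hA : (Matrix.of fun i j => ∑ k, ((![!![0, 0, 0, 1, 1; 0, 1, 1, 0, 1; 1, 0, 1, 1, 0],
        !![-1, 1, 0, -1, 0; -1, 0, 1, -1, 0; 0, 0, 0, 0, 1]] k i j : ℤ) : K) * y k) =
        !![-b, b, 0, a - b, a; -b, a, a + b, -b, a; a, 0, a, a, b] := by
      ext i j; fin_cases i <;> fin_cases j <;> (simp [ha, hb]; try ring)
    rw [hA, MinorsVanish, pairPerm_three] at h
    have h1 : 4 * a ^ 4 * b ^ 8 = 0 := by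
      refine Eq.trans ?_ (h ![0, 1, 3, 4] ![0, 1, 3, 4])
      rw [det_fin_four]
      simp [perm₃]
      ring
    have h2 := h ![0, 1, 2, 4] ![0, 1, 2, 4]
    have h3 := h ![0, 1, 2, 3] ![0, 1, 2, 3]
    rw [det_fin_four] at h2 h3
    have : a = 0 ∧ b = 0 := by
      have hab : a = 0 ∨ b = 0 := by simpa using h1
      rcases hab with rfl | rfl
      · simp [perm₃] at h3
        ring_nf at h3
        exact ⟨rfl, by simpa using h3⟩
      · simp [perm₃] at h2
        ring_nf at h2
        exact ⟨by simpa using h2, rfl⟩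
    funext k
    fin_cases k <;> simp [ha, hb, this]

theorem hasTrivialSection_three_three_three : HasTrivialSection 3 3 3 := by
  refine HasTrivialSection.intro ![(0, 0), (1, 0), (2, 0)]
    ![!![1, 1, -2, 0, 0; 0, 0, 0, 0, 2; 0, 0, 0, 1, 0],
      !![0, 0, 0, 0, 1; 1, 1, 0, -2, 0; 0, 0, -1, 0, 0],
      !![0, 0, 0, 1, 0; 0, 0, 1, 0, 0; 1, -1, 0, 0, -1]] ?_ ?_
  · decide
  · intro K _ _ y h
    obtain ⟨a, ha⟩ : ∃ a, y 0 = a := ⟨_, rfl⟩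
    obtain ⟨b, hb⟩ : ∃ b, y 1 = b := ⟨_, rfl⟩
    obtain ⟨c, hc⟩ : ∃ c, y 2 = c := ⟨_, rfl⟩
    have hA : (Matrix.of fun i j => ∑ k, ((![!![1, 1, -2, 0, 0; 0, 0, 0, 0, 2; 0, 0, 0, 1, 0],
        !![0, 0, 0, 0, 1; 1, 1, 0, -2, 0; 0, 0, -1, 0, 0],
        !![0, 0, 0, 1, 0; 0, 0, 1, 0, 0; 1, -1, 0, 0, -1]] k i j : ℤ) : K) * y k) =
        !![a, a, -2 * a, c, b; b, b, c, -2 * b, 2 * a; c, -c, -b, a, -c] := by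
      ext i j; fin_cases i <;> fin_cases j <;> simp [Fin.sum_univ_succ, ha, hb, hc]
    rw [hA] at h
    have hdet (f g : Fin 3 → Fin 5) := h f g
    simp only [pairPerm_three, Matrix.det_fin_three] at hdet
    have h1 : 16 * a ^ 4 * b ^ 4 * c = 0 := by
      refine Eq.trans ?_ (hdet ![2, 3, 4] ![2, 3, 4])
      simp [perm₃]
      ring
    have hbc (h0 : a = 0) : b = 0 ∨ c = 0 := by
      subst h0
      have e1 := hdet ![0, 1, 3] ![1, 2, 4]
      have e2 := hdet ![0, 1, 4] ![0, 2, 3]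
      have e3 := hdet ![0, 1, 3] ![0, 1, 4]
      simp [perm₃] at e1 e2 e3
      ring_nf at e1 e2 e3
      by_contra! hne
      have E : c ^ 3 + 2 * b ^ 3 = 0 := by
        have : b ^ 4 * c ^ 2 * (c ^ 3 + 2 * b ^ 3) = 0 := by linear_combination (e1 + e2) / 4
        simpa [hne.1, hne.2] using this
      have F : b + 2 * c = 0 := by
        have : b ^ 7 * c * (b + 2 * c) = 0 := by
          linear_combination
            (e3 - (2 * b * c ^ 2 * (c ^ 3 - 2 * b ^ 3) - 4 * b ^ 4 * c ^ 2 - 2 * b ^ 5 * c) * E) / 8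
        simpa [hne.1, hne.2] using this
      have : c ^ 3 = 0 := by
        linear_combination (2 * (b ^ 2 - 2 * b * c + 4 * c ^ 2) * F - E) / 15
      exact hne.2 (by simpa using this)
    have hac (h0 : b = 0) : a = 0 ∨ c = 0 := by
      subst h0
      have e1 := hdet ![0, 1, 2] ![1, 3, 4]
      have e2 := hdet ![0, 1, 2] ![0, 3, 4]
      have e3 := hdet ![0, 1, 2] ![0, 1, 4]
      simp [perm₃] at e1 e2 e3
      ring_nf at e1 e2 e3
      by_contra! hne
      have E : c ^ 3 - 4 * a ^ 3 = 0 := by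
        have : a ^ 4 * c ^ 2 * (c ^ 3 - 4 * a ^ 3) = 0 := by linear_combination -(e1 + e2) / 8
        simpa [hne.1, hne.2] using this
      have F : a - 4 * c = 0 := by
        have : a ^ 7 * c * (a - 4 * c) = 0 := by
          linear_combination
            -(e3 - (4 * a * c ^ 2 * (c ^ 3 + 4 * a ^ 3) + 16 * a ^ 4 * c ^ 2 - 4 * a ^ 5 * c) * E) / 32
        simpa [hne.1, hne.2] using this
      have : c ^ 3 = 0 := by
        linear_combination -(4 * (a ^ 2 + 4 * a * c + 16 * c ^ 2) * F + E) / 255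
      exact hne.2 (by simpa using this)
    have hab (h0 : c = 0) : a = 0 ∨ b = 0 := by
      subst h0
      have e1 := hdet ![0, 2, 4] ![1, 2, 4]
      have e2 := hdet ![1, 3, 4] ![1, 3, 4]
      simp [perm₃] at e1 e2
      ring_nf at e1 e2
      by_contra! hne
      have F : b - 2 * a = 0 := by
        have : a ^ 5 * b ^ 3 * (b - 2 * a) = 0 := by linear_combination -e1 / 8
        simpa [hne.1, hne.2] using this
      have : a ^ 5 * b ^ 4 = 0 := by
        linear_combination (e2 - 8 * a ^ 2 * b ^ 4 * (b ^ 2 + a * b + 4 * a ^ 2) * F) / 48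
      simp [hne.1, hne.2] at this
    have ha0 (h2 : b = 0) (h3 : c = 0) : a = 0 := by
      subst h2; subst h3
      have e := hdet ![0, 1, 2] ![0, 1, 2]
      simp [perm₃] at e
      ring_nf at e
      simpa using e
    have hb0 (h2 : a = 0) (h3 : c = 0) : b = 0 := by
      subst h2; subst h3
      have e := hdet ![0, 1, 3] ![0, 1, 3]
      simp [perm₃] at e
      ring_nf at e
      simpa using e
    have hc0 (h2 : a = 0) (h3 : b = 0) : c = 0 := by
      subst h2; subst h3
      have e := hdet ![0, 1, 4] ![0, 1, 4]
      simp [perm₃] at e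
      ring_nf at e
      simpa using e
    have : a = 0 ∧ b = 0 ∧ c = 0 := by
      have h2 : (a = 0 ∨ b = 0) ∨ c = 0 := by simpa using h1
      tauto
    funext k
    fin_cases k <;> simp [ha, hb, hc, this]

/-- For a field `F` of characteristic zero, `Ideal.height I_{3,4} = 4` and
`Ideal.height I_{4,5} = 5`: the varieties `P_{3,4}` and `P_{4,5}` are complete
intersections of codimensions `4` and `5` respectively. -/
theorem statement9 (F : Type*) [Field F] [CharZero F] :
    idealHeight (permanentalIdeal F 3) = (4 : ℕ∞) ∧
      idealHeight (permanentalIdeal F 4) = (5 : ℕ∞) := by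
  constructor
  · refine le_antisymm (idealHeight_permanentalIdeal_le F 2)
      (le_idealHeight_permanentalIdeal F (m := 2) fun r hr => ?_)
    interval_cases r
    · exact ⟨4, by norm_num, hasTrivialSection_two_two_four.of_succ⟩
    · exact ⟨4, by norm_num, hasTrivialSection_two_two_four⟩
    · exact ⟨2, by norm_num, hasTrivialSection_two_three_two⟩
    · exact ⟨1, by norm_num, hasTrivialSection_two_four_one⟩
  · refine le_antisymm (idealHeight_permanentalIdeal_le F 3)
      (le_idealHeight_permanentalIdeal F (m := 3) fun r hr => ?_)
    interval_cases r
    · exact ⟨5, by norm_num, hasTrivialSection_three_two_five.of_succ⟩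
    · exact ⟨5, by norm_num, hasTrivialSection_three_two_five⟩
    · exact ⟨3, by norm_num, hasTrivialSection_three_three_three⟩
    · exact ⟨2, by norm_num, hasTrivialSection_three_four_two⟩
    · exact ⟨1, by norm_num, hasTrivialSection_three_five_one⟩

end
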